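/- Let A be a weighted pushdown system. If there exists an infinite valid path π from the initial configuration with LimSupAvg(π) > 0, then there exists an ultimately periodic infinite valid path π' from the initial configuration such that both LimSupAvg(π') > 0 and LimInfAvg(π') > 0. -/

import Mathlib

open scoped BigOperators

namespace PDS

/-- Stack commands over a stack alphabet `Γ`. -/
inductive Com (Γ : Type) where
  | skip : Com Γ
  | pop : Com Γ
  | push (z : Γ) : Com Γ
  deriving DecidableEq

/-- Action of a stack command on a stack string (top of stack at the head). -/
def Com.apply {Γ : Type} : Com Γ → List Γ → List Γ
  | .skip, α => α
  | .pop, α => α.tail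
  | .push z, α => z :: α

/-- A transition (edge) of a pushdown system. -/
structure Edge (Q Γ : Type) where
  q1 : Q
  top : Γ
  q2 : Q
  com : Com Γ
  deriving DecidableEq

/-- A weighted pushdown system. -/
structure WPS (Q Γ : Type) where
  q0 : Q
  bot : Γ
  E : Set (Edge Q Γ)
  w : Edge Q Γ → ℤ
  no_push_bot : ∀ e ∈ E, e.com ≠ Com.push bot
  no_pop_bot : ∀ e ∈ E, e.top = bot → e.com ≠ Com.pop

variable {Q Γ : Type}

/-- A configuration: stack string (top at head) together with a state. -/
abbrev Config (Q Γ : Type) := List Γ × Q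

/-- A genuine configuration has a nonempty stack string. -/
def IsConfig (c : Config Q Γ) : Prop := c.1 ≠ []

/-- The initial configuration `(⊥, q₀)`. -/
def WPS.start (A : WPS Q Γ) : Config Q Γ := ([A.bot], A.q0)

/-- The configuration obtained by taking the edge `e` from `c`. -/
def next (c : Config Q Γ) (e : Edge Q Γ) : Config Q Γ := (e.com.apply c.1, e.q2)

/-- The edge `e` is enabled at configuration `c`. -/
def WPS.Enabled (A : WPS Q Γ) (c : Config Q Γ) (e : Edge Q Γ) : Prop :=
  e ∈ A.E ∧ c.2 = e.q1 ∧ c.1.head? = some e.top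

/-- Validity of a finite path, given by a start configuration and a list of edges. -/
def WPS.Valid (A : WPS Q Γ) : Config Q Γ → List (Edge Q Γ) → Prop
  | _, [] => True
  | c, e :: es => A.Enabled c e ∧ A.Valid (next c e) es

/-- Last configuration of the finite path `(c, es)`. -/
def endc (c : Config Q Γ) (es : List (Edge Q Γ)) : Config Q Γ := es.foldl next c

/-- The list of configurations along the finite path `(c, es)`. -/
def trace (c : Config Q Γ) (es : List (Edge Q Γ)) : List (Config Q Γ) :=
  List.scanl next c es

/-- Total weight of a finite path. -/
def WPS.wt (A : WPS Q Γ) (es : List (Edge Q Γ)) : ℤ := (es.map A.w).sum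

/-- Stack height of a configuration. -/
def height (c : Config Q Γ) : ℕ := c.1.length

/-- Stack height of a finite path: maximal stack height along it. -/
def SH (c : Config Q Γ) (es : List (Edge Q Γ)) : ℕ :=
  ((trace c es).map height).foldr max 0

/-- Additional stack height of a finite path. -/
def ASH (c : Config Q Γ) (es : List (Edge Q Γ)) : ℕ :=
  SH c es - max (height c) (height (endc c es))

/-- The first configuration of the path is a local minima: its stack string is a
prefix (here: suffix of the list, since the top is at the head) of all stack strings
along the path. -/
def FirstMin (c : Config Q Γ) (es : List (Edge Q Γ)) : Prop :=
  ∀ c' ∈ trace c es, c.1 <:+ c'.1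

/-- The edge sequence obtained from `u ++ p₁ ++ v ++ p₂ ++ x` by repeating `p₁` and
`p₂` each `j` times in place. -/
def pumped (u p₁ v p₂ x : List (Edge Q Γ)) (j : ℕ) : List (Edge Q Γ) :=
  u ++ (List.replicate j p₁).flatten ++ v ++ (List.replicate j p₂).flatten ++ x

/-- `(p₁, p₂)` is a pumpable pair of paths for the path `(c, es)`. -/
def WPS.PumpablePair (A : WPS Q Γ) (c : Config Q Γ) (es p₁ p₂ : List (Edge Q Γ)) : Prop :=
  p₁ ≠ [] ∧ p₂ ≠ [] ∧
    ∃ u v x, es = u ++ p₁ ++ v ++ p₂ ++ x ∧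
      ∀ j : ℕ, A.Valid c (pumped u p₁ v p₂ x j)

/-- The path `(c, es)` has a pumpable pair of paths. -/
def WPS.HasPumpablePair (A : WPS Q Γ) (c : Config Q Γ) (es : List (Edge Q Γ)) : Prop :=
  ∃ p₁ p₂, A.PumpablePair c es p₁ p₂

/-- `(c, es)` is a good cycle. -/
def WPS.GoodCycle (A : WPS Q Γ) (c : Config Q Γ) (es : List (Edge Q Γ)) : Prop :=
  A.Valid c es ∧ 0 < A.wt es ∧ FirstMin c es ∧
    (endc c es).2 = c.2 ∧ (endc c es).1.head? = c.1.head?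

/-- `A` has a good cycle reachable from the configuration `c`. -/
def WPS.ReachableGoodCycleFrom (A : WPS Q Γ) (c : Config Q Γ) : Prop :=
  ∃ es₀ es, A.Valid c es₀ ∧ A.GoodCycle (endc c es₀) es

/-- `A` has a good cycle (at some configuration). -/
def WPS.HasGoodCycle (A : WPS Q Γ) : Prop :=
  ∃ c es, IsConfig c ∧ A.GoodCycle c es

/-- The finite path `(c, es)` contains a good cycle. -/
def ContainsGoodCycle (A : WPS Q Γ) (c : Config Q Γ) (es : List (Edge Q Γ)) : Prop :=
  ∃ es₁ es₂, es = es₁ ++ es₂ ∧ A.GoodCycle (endc c es₁) es₂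

/-- Configurations along an infinite path given by an infinite edge sequence. -/
def confs (c : Config Q Γ) (f : ℕ → Edge Q Γ) : ℕ → Config Q Γ
  | 0 => c
  | n + 1 => next (confs c f n) (f n)

/-- Validity of the infinite path `(c, f)`. -/
def WPS.ValidInf (A : WPS Q Γ) (c : Config Q Γ) (f : ℕ → Edge Q Γ) : Prop :=
  ∀ n, A.Enabled (confs c f n) (f n)

/-- Average weight of the prefix of length `n+1` of an infinite path. -/
noncomputable def avgPref (A : WPS Q Γ) (f : ℕ → Edge Q Γ) (n : ℕ) : ℝ :=
  (∑ i ∈ Finset.range (n + 1), (A.w (f i) : ℝ)) / (n + 1)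

/-- Limit-sup of the averages along an infinite path. -/
noncomputable def LimSupAvg (A : WPS Q Γ) (f : ℕ → Edge Q Γ) : ℝ :=
  Filter.limsup (avgPref A f) Filter.atTop

/-- Limit-inf of the averages along an infinite path. -/
noncomputable def LimInfAvg (A : WPS Q Γ) (f : ℕ → Edge Q Γ) : ℝ :=
  Filter.liminf (avgPref A f) Filter.atTop

/-- An infinite edge sequence is ultimately periodic. -/
def UltPeriodic (f : ℕ → Edge Q Γ) : Prop :=
  ∃ N p : ℕ, 0 < p ∧ ∀ n, N ≤ n → f (n + p) = f n

/-- The infinite path `(c, f)` is stack bounded. -/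
def StackBounded (c : Config Q Γ) (f : ℕ → Edge Q Γ) : Prop :=
  ∃ n : ℕ, ∀ k, height (confs c f k) ≤ n

/-- Non-decreasing path: a valid path whose first configuration is a local minima. -/
def WPS.NonDec (A : WPS Q Γ) (c : Config Q Γ) (es : List (Edge Q Γ)) : Prop :=
  A.Valid c es ∧ FirstMin c es

/-- Summary function, valued in `EReal`: `⊥` means there is no non-decreasing path
from `(⊥γ,q₁)` to `(⊥γ,q₂)`, `⊤` means `ω` (weights unbounded from above), and
otherwise the value is the maximal weight of such a path. -/
noncomputable def WPS.summary (A : WPS Q Γ) (q₁ : Q) (γ : Γ) (q₂ : Q) : EReal :=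
  sSup { x : EReal | ∃ es, A.NonDec ([γ, A.bot], q₁) es ∧
    endc ([γ, A.bot], q₁) es = ([γ, A.bot], q₂) ∧ x = ((A.wt es : ℝ) : EReal) }

/-- Stack height bounded summary function: as `summary` but only over non-decreasing
paths of additional stack height at most `d`. -/
noncomputable def WPS.summaryBdd (A : WPS Q Γ) (d : ℕ) (q₁ : Q) (γ : Γ) (q₂ : Q) : EReal :=
  sSup { x : EReal | ∃ es, A.NonDec ([γ, A.bot], q₁) es ∧
    endc ([γ, A.bot], q₁) es = ([γ, A.bot], q₂) ∧ ASH ([γ, A.bot], q₁) es ≤ d ∧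
    x = ((A.wt es : ℝ) : EReal) }

/-- Edges of the summary graph `Gr(A)` together with their weights in `EReal`
(`⊤` plays the role of `ω`): skip edges weighted by the summary function and push
edges weighted by the corresponding transition weight. -/
def WPS.GrEdge (A : WPS Q Γ) (v₁ v₂ : Q × Γ) (x : EReal) : Prop :=
  (v₁.2 = v₂.2 ∧ A.summary v₁.1 v₁.2 v₂.1 ≠ ⊥ ∧ x = A.summary v₁.1 v₁.2 v₂.1) ∨
  (∃ e ∈ A.E, e.q1 = v₁.1 ∧ e.top = v₁.2 ∧ e.q2 = v₂.1 ∧ e.com = Com.push v₂.2 ∧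
    x = ((A.w e : ℝ) : EReal))

/-- The summary graph `Gr(A)` has a positive simple cycle: a simple cycle containing
an `ω`-edge or whose total weight is positive. -/
def WPS.PosSimpleCycle (A : WPS Q Γ) : Prop :=
  ∃ (k : ℕ) (v : Fin (k + 1) → Q × Γ) (x : Fin (k + 1) → EReal),
    Function.Injective v ∧ (∀ i, A.GrEdge (v i) (v (i + 1)) (x i)) ∧
    ((∃ i, x i = ⊤) ∨ (0 : EReal) < ∑ i, x i)

/-- Weight of a finite path under the shifted weight function `w + r`. -/
def WPS.wtQ (A : WPS Q Γ) (r : ℚ) (es : List (Edge Q Γ)) : ℚ :=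
  (es.map (fun e => (A.w e : ℚ) + r)).sum

/-- The shifted system `A^r` (weight function `w + r`) has a good cycle. -/
def WPS.GoodCycleShift (A : WPS Q Γ) (r : ℚ) : Prop :=
  ∃ c es, IsConfig c ∧ A.Valid c es ∧ 0 < A.wtQ r es ∧ FirstMin c es ∧
    (endc c es).2 = c.2 ∧ (endc c es).1.head? = c.1.head?

end PDS

namespace PDS

open Filter

variable {Q Γ : Type}

theorem finite_edge [Finite Q] [Finite Γ] : Finite (Edge Q Γ) := by
  have : Finite (Com Γ) := by
    refine Finite.of_injective
      (fun c : Com Γ => match c with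
        | .skip => (none : Option (Option Γ))
        | .pop => some none
        | .push z => some (some z)) ?_
    intro a b hab
    cases a <;> cases b <;> simp_all
  refine Finite.of_injective (fun e : Edge Q Γ => (e.q1, e.top, e.q2, e.com)) ?_
  rintro ⟨⟩ ⟨⟩ h
  simp_all

/-- `es` is a valid path from `c` to `c'`. -/
def WPS.Run (A : WPS Q Γ) (c : Config Q Γ) (es : List (Edge Q Γ)) (c' : Config Q Γ) : Prop :=
  A.Valid c es ∧ endc c es = c'

theorem WPS.valid_append (A : WPS Q Γ) (c : Config Q Γ) (es es' : List (Edge Q Γ)) :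
    A.Valid c (es ++ es') ↔ A.Valid c es ∧ A.Valid (endc c es) es' := by
  induction es generalizing c with
  | nil => simp [WPS.Valid, endc]
  | cons e es ih => simp [WPS.Valid, ih, endc, and_assoc]

theorem WPS.Run.append {A : WPS Q Γ} {c c' c'' : Config Q Γ} {es es' : List (Edge Q Γ)}
    (h : A.Run c es c') (h' : A.Run c' es' c'') : A.Run c (es ++ es') c'' := by
  obtain ⟨hv, rfl⟩ := h
  obtain ⟨hv', rfl⟩ := h'
  exact ⟨(A.valid_append _ _ _).2 ⟨hv, hv'⟩, by simp [endc]⟩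

theorem WPS.Run.snoc {A : WPS Q Γ} {c c' : Config Q Γ} {es : List (Edge Q Γ)} {e : Edge Q Γ}
    (h : A.Run c es c') (he : A.Enabled c' e) : A.Run c (es ++ [e]) (next c' e) :=
  h.append ⟨⟨he, trivial⟩, rfl⟩

theorem WPS.Valid.enabled_getElem {A : WPS Q Γ} {c : Config Q Γ} {es : List (Edge Q Γ)}
    (h : A.Valid c es) (i : ℕ) (hi : i < es.length) :
    A.Enabled (endc c (es.take i)) es[i] := by
  rw [← List.take_append_drop i es, A.valid_append, List.drop_eq_getElem_cons hi] at h
  exact h.2.1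

theorem Com.apply_append (k : Com Γ) {x : List Γ} (hx : x ≠ []) (ρ : List Γ) :
    k.apply (x ++ ρ) = k.apply x ++ ρ := by
  cases k <;> simp [Com.apply, List.tail_append_of_ne_nil, hx]

theorem WPS.Run.lift {A : WPS Q Γ} {x x' : List Γ} {q q' : Q} {es : List (Edge Q Γ)}
    (h : A.Run (x, q) es (x', q')) (ρ : List Γ) : A.Run (x ++ ρ, q) es (x' ++ ρ, q') := by
  induction es generalizing x q with
  | nil =>
    obtain ⟨-, h⟩ := h
    simp only [endc, List.foldl_nil, Prod.mk.injEq] at h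
    exact ⟨trivial, by simp [endc, h]⟩
  | cons e es ih =>
    obtain ⟨⟨⟨hE, hq, ht⟩, hv⟩, hend⟩ := h
    have hx : x ≠ [] := by rintro rfl; simp at ht
    obtain ⟨hv', hend'⟩ := ih (x := e.com.apply x) (q := e.q2) ⟨hv, hend⟩
    have hn : next (x ++ ρ, q) e = (e.com.apply x ++ ρ, e.q2) := by
      simp [next, e.com.apply_append hx]
    refine ⟨⟨⟨hE, hq, ?_⟩, hn ▸ hv'⟩, ?_⟩
    · simpa [List.head?_append_of_ne_nil _ hx] using ht
    · rw [← hend', ← hn]; rfl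

theorem WPS.wt_append (A : WPS Q Γ) (es es' : List (Edge Q Γ)) :
    A.wt (es ++ es') = A.wt es + A.wt es' := by
  simp [WPS.wt]

/-- Total weight of the first `n` edges of an infinite edge sequence. -/
def WPS.prefixWt (A : WPS Q Γ) (f : ℕ → Edge Q Γ) (n : ℕ) : ℤ :=
  ∑ i ∈ Finset.range n, A.w (f i)

theorem WPS.prefixWt_succ (A : WPS Q Γ) (f : ℕ → Edge Q Γ) (n : ℕ) :
    A.prefixWt f (n + 1) = A.prefixWt f n + A.w (f n) :=
  Finset.sum_range_succ _ _

theorem avgPref_eq (A : WPS Q Γ) (f : ℕ → Edge Q Γ) (n : ℕ) :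
    avgPref A f n = (A.prefixWt f (n + 1) : ℝ) / (n + 1) := by
  simp [avgPref, WPS.prefixWt]

/-- A segment of an infinite path that never touches the bottom part `ρ` of the stack
can be replayed without `ρ`. -/
theorem WPS.ValidInf.exists_run {A : WPS Q Γ} {c : Config Q Γ} {f : ℕ → Edge Q Γ}
    (hf : A.ValidInf c f) {a b : ℕ} (hab : a ≤ b) {x ρ : List Γ}
    (hx : (confs c f a).1 = x ++ ρ)
    (hh : ∀ t, a ≤ t → t ≤ b → ρ.length < height (confs c f t)) :
    ∃ es x', A.Run (x, (confs c f a).2) es (x', (confs c f b).2) ∧ x' ≠ [] ∧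
      (confs c f b).1 = x' ++ ρ ∧ A.wt es = A.prefixWt f b - A.prefixWt f a := by
  induction b, hab using Nat.le_induction with
  | base =>
    refine ⟨[], x, ⟨trivial, rfl⟩, ?_, hx, by simp [WPS.wt]⟩
    rintro rfl
    have := hh a le_rfl le_rfl
    simp [height, hx] at this
  | succ b hab ih =>
    obtain ⟨es, x', hrun, hne, hb, hw⟩ := ih fun t h1 h2 => hh t h1 (by omega)
    obtain ⟨hE, hq, ht⟩ := hf b
    have hstk : (confs c f (b + 1)).1 = (f b).com.apply x' ++ ρ := by
      rw [← (f b).com.apply_append hne, ← hb]; rfl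
    refine ⟨es ++ [f b], (f b).com.apply x', hrun.snoc ⟨hE, hq, ?_⟩, ?_, hstk, ?_⟩
    · rwa [hb, List.head?_append_of_ne_nil _ hne] at ht
    · intro h0
      have := hh (b + 1) (by omega) le_rfl
      simp [height, hstk, h0] at this
    · rw [A.wt_append, hw, A.prefixWt_succ]; simp [WPS.wt]; ring

/-- The state and top symbol of a configuration. -/
def vertex (c : Config Q Γ) : Q × Option Γ := (c.2, c.1.head?)

theorem WPS.ValidInf.exists_cons {A : WPS Q Γ} {c : Config Q Γ} {f : ℕ → Edge Q Γ}
    (hf : A.ValidInf c f) (n : ℕ) : ∃ γ ρ, (confs c f n).1 = γ :: ρ := by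
  have h := (hf n).2.2
  cases hs : (confs c f n).1 with
  | nil => simp [hs] at h
  | cons γ ρ => exact ⟨γ, ρ, rfl⟩

theorem height_confs_succ_le (c : Config Q Γ) (f : ℕ → Edge Q Γ) (n : ℕ) :
    height (confs c f (n + 1)) ≤ height (confs c f n) + 1 := by
  simp only [confs, height, next]
  cases (f n).com <;> simp [Com.apply]
  omega

/-- A segment of an infinite path between two configurations with the same state and top
symbol, the first of which is of minimal height, is a cycle. -/
theorem WPS.ValidInf.exists_cycle {A : WPS Q Γ} {c : Config Q Γ} {f : ℕ → Edge Q Γ}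
    (hf : A.ValidInf c f) {a b : ℕ} (hab : a ≤ b)
    (hh : ∀ t, a ≤ t → t ≤ b → height (confs c f a) ≤ height (confs c f t))
    (hv : vertex (confs c f b) = vertex (confs c f a)) {γ : Γ} {ρ : List Γ}
    (ha : (confs c f a).1 = γ :: ρ) :
    ∃ es x, A.Run ([γ], (confs c f a).2) es (γ :: x, (confs c f a).2) ∧
      A.wt es = A.prefixWt f b - A.prefixWt f a := by
  obtain ⟨es, x', hrun, hne, hb, hw⟩ := hf.exists_run hab (x := [γ]) (ρ := ρ) ha
    fun t h1 h2 => by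
      have := hh t h1 h2
      simp only [height, ha, List.length_cons] at this ⊢
      omega
  simp only [vertex, Prod.mk.injEq] at hv
  obtain ⟨δ, x, rfl⟩ := List.exists_cons_of_ne_nil hne
  have : δ = γ := by simpa [ha, hb] using hv.2
  subst this
  exact ⟨es, x, hv.1 ▸ hrun, hw⟩

/-- Along `f` no cycle of positive weight can be entered. -/
def WPS.NoCycle (A : WPS Q Γ) (c : Config Q Γ) (f : ℕ → Edge Q Γ) : Prop :=
  ∀ a γ ρ es x, (confs c f a).1 = γ :: ρ →
    A.Run ([γ], (confs c f a).2) es (γ :: x, (confs c f a).2) → A.wt es ≤ 0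

/-- Bound on the weight of a segment starting in a configuration of minimal height, given
bounds on the single edges and on the segments that return to their initial height. -/
theorem WPS.NoCycle.prefixWt_sub_le
    {A : WPS Q Γ} {c : Config Q Γ} {f : ℕ → Edge Q Γ}
    (hf : A.ValidInf c f) (hc : A.NoCycle c f) {M C : ℤ} {m n : ℕ} (hM0 : 0 ≤ M) (hC0 : 0 ≤ C)
    (hM : ∀ i, A.w (f i) ≤ M)
    (hC : ∀ a b, m ≤ a → a ≤ b →
      (∀ t, a ≤ t → t ≤ b → height (confs c f a) ≤ height (confs c f t)) →
      height (confs c f b) = height (confs c f a) → A.prefixWt f b - A.prefixWt f a ≤ C)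
    (F : Finset (Q × Option Γ)) :
    ∀ a, m ≤ a → a ≤ n →
      (∀ t, a ≤ t → t ≤ n → height (confs c f a) ≤ height (confs c f t)) →
      (∀ t, a ≤ t → t ≤ n →
        (∀ s, t ≤ s → s ≤ n → height (confs c f t) ≤ height (confs c f s)) →
        vertex (confs c f t) ∈ F) →
      A.prefixWt f n - A.prefixWt f a ≤ F.card * (C + M) := by
  classical
  induction F using Finset.strongInduction with
  | H F ih =>
  intro a hma han hmin hF
  have haF := hF a le_rfl han hmin
  obtain ⟨t, ⟨hat, htn, htmin, htv⟩, htlast⟩ :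
      ∃ t, (a ≤ t ∧ t ≤ n ∧
          (∀ s, t ≤ s → s ≤ n → height (confs c f t) ≤ height (confs c f s)) ∧
          vertex (confs c f t) = vertex (confs c f a)) ∧
        ∀ t', t < t' → t' ≤ n →
          (∀ s, t' ≤ s → s ≤ n → height (confs c f t') ≤ height (confs c f s)) →
          vertex (confs c f t') ≠ vertex (confs c f a) := by
    let P : ℕ → Prop := fun t => a ≤ t ∧ t ≤ n ∧
      (∀ s, t ≤ s → s ≤ n → height (confs c f t) ≤ height (confs c f s)) ∧
      vertex (confs c f t) = vertex (confs c f a)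
    have hP : P a := ⟨le_rfl, han, hmin, rfl⟩
    refine ⟨Nat.findGreatest P n, Nat.findGreatest_spec (P := P) han hP, ?_⟩
    intro t' h1 h2 h3 h4
    exact Nat.findGreatest_is_greatest h1 h2
      ⟨(Nat.le_findGreatest han hP).trans h1.le, h2, h3, h4⟩
  have hcyc : A.prefixWt f t - A.prefixWt f a ≤ 0 := by
    obtain ⟨γ, ρ, hγ⟩ := hf.exists_cons a
    obtain ⟨es, x, hrun, hw⟩ := hf.exists_cycle hat (fun s h1 h2 => hmin s h1 (by omega)) htv hγ
    exact hw ▸ hc a γ ρ es x hγ hrun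
  obtain ⟨b, ⟨htb, hbn, hbh⟩, hblast⟩ :
      ∃ b, (t ≤ b ∧ b ≤ n ∧ height (confs c f b) = height (confs c f t)) ∧
        ∀ s, b < s → s ≤ n → height (confs c f s) ≠ height (confs c f t) := by
    let P : ℕ → Prop := fun b => t ≤ b ∧ b ≤ n ∧ height (confs c f b) = height (confs c f t)
    have hP : P t := ⟨le_rfl, htn, rfl⟩
    refine ⟨Nat.findGreatest P n, Nat.findGreatest_spec (P := P) htn hP, ?_⟩
    intro s h1 h2 h3
    exact Nat.findGreatest_is_greatest h1 h2
      ⟨(Nat.le_findGreatest htn hP).trans h1.le, h2, h3⟩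
  have hlevel := hC t b (by omega) htb (fun s h1 h2 => htmin s h1 (by omega)) hbh
  have hcard := Finset.card_erase_add_one haF
  have hcardZ : (F.card : ℤ) = (F.erase (vertex (confs c f a))).card + 1 := by
    exact_mod_cast hcard.symm
  rcases hbn.eq_or_lt with rfl | hbn
  · have : 0 ≤ ((F.erase (vertex (confs c f a))).card : ℤ) * (C + M) := by positivity
    rw [hcardZ]
    linarith
  · have hup : ∀ s, b + 1 ≤ s → s ≤ n →
        height (confs c f (b + 1)) ≤ height (confs c f s) := by
      intro s h1 h2
      have h3 := htmin s (by omega) h2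
      have h4 := hblast s (by omega) h2
      have h5 := height_confs_succ_le c f b
      omega
    have hrest := ih (F.erase (vertex (confs c f a))) (Finset.erase_ssubset haF) (b + 1)
      (by omega) hbn hup fun s h1 h2 h3 =>
        Finset.mem_erase.2 ⟨htlast s (by omega) h2 h3, hF s (by omega) h2 h3⟩
    have hstep := A.prefixWt_succ f b
    have := hM b
    rw [hcardZ]
    linarith

/-- Some pair of state and top symbol occurs infinitely often at configurations whose height
is minimal among all later ones. -/
theorem exists_frequently_min [Finite Q] [Finite Γ] (s : ℕ → Config Q Γ) :
    ∃ v, ∀ N, ∃ m, N ≤ m ∧ (∀ t, m ≤ t → height (s m) ≤ height (s t)) ∧ vertex (s m) = v := by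
  have hmin : ∀ N, ∃ m, N ≤ m ∧ ∀ t, m ≤ t → height (s m) ≤ height (s t) := by
    intro N
    obtain ⟨m, hm, h⟩ := WellFounded.has_min (measure fun m => height (s m)).wf
      (Set.Ici N) ⟨N, Set.self_mem_Ici⟩
    exact ⟨m, hm, fun t ht => not_lt.1 (h t (le_trans hm ht))⟩
  by_contra! hcon
  choose N hN using hcon
  obtain ⟨B, hB⟩ := (Set.finite_range N).bddAbove
  obtain ⟨m, hBm, hm⟩ := hmin B
  exact hN (vertex (s m)) m ((hB ⟨_, rfl⟩).trans hBm) hm rfl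

theorem WPS.NoCycle.exists_prefixWt_le [Finite Q] [Finite Γ]
    {A : WPS Q Γ} {c : Config Q Γ} {f : ℕ → Edge Q Γ}
    (hf : A.ValidInf c f) (hc : A.NoCycle c f) :
    ∃ K : ℤ, ∀ᶠ n in atTop, A.prefixWt f n ≤ K := by
  classical
  have := Fintype.ofFinite Q
  have := Fintype.ofFinite Γ
  have : Finite (Edge Q Γ) := finite_edge
  obtain ⟨v, hv⟩ := exists_frequently_min (confs c f)
  obtain ⟨m, -, hmmin, hmv⟩ := hv 0
  obtain ⟨γ, ρ, hγ⟩ := hf.exists_cons m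
  obtain ⟨M, hM⟩ := (Set.finite_range A.w).bddAbove
  let lev : (Γ × Q) × (Γ × Q) → Set ℤ := fun p =>
    {z | ∃ es, A.Run ([p.1.1], p.1.2) es ([p.2.1], p.2.2) ∧ z = A.wt es}
  have hbd : ∃ C, ∀ p, BddAbove (lev p) → ∀ z ∈ lev p, z ≤ C := by
    have : ∀ p, ∃ C, BddAbove (lev p) → ∀ z ∈ lev p, z ≤ C := by
      intro p
      by_cases h : BddAbove (lev p)
      · obtain ⟨C, hC⟩ := h
        exact ⟨C, fun _ z hz => hC hz⟩
      · exact ⟨0, fun h' => absurd h' h⟩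
    choose C hC using this
    obtain ⟨B, hB⟩ := (Set.finite_range C).bddAbove
    exact ⟨B, fun p hp z hz => (hC p hp z hz).trans (hB ⟨p, rfl⟩)⟩
  obtain ⟨C, hC⟩ := hbd
  have hlevel : ∀ a b, m ≤ a → a ≤ b →
      (∀ t, a ≤ t → t ≤ b → height (confs c f a) ≤ height (confs c f t)) →
      height (confs c f b) = height (confs c f a) →
      A.prefixWt f b - A.prefixWt f a ≤ max C 0 := by
    intro a b hma hab hmin hbh
    have hρ : ∀ t, m ≤ t → ρ.length < height (confs c f t) := by
      intro t ht
      have := hmmin t ht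
      simp only [height, hγ, List.length_cons] at this ⊢
      omega
    obtain ⟨es₁, y, hrun₁, hy, hya, -⟩ :=
      hf.exists_run hma (x := [γ]) (ρ := ρ) hγ fun t h1 _ => hρ t h1
    obtain ⟨δ, y, rfl⟩ := List.exists_cons_of_ne_nil hy
    obtain ⟨es₂, z, hrun₂, -, hzb, hw₂⟩ :=
      hf.exists_run hab (x := [δ]) (ρ := y ++ ρ) (by simpa using hya) fun t h1 h2 => by
        have := hmin t h1 h2
        simp only [height, hya, List.length_cons, List.cons_append] at this ⊢
        omega
    have hz : z.length = 1 := by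
      simp only [height, hzb, hya, List.length_append, List.length_cons] at hbh
      omega
    obtain ⟨δ', rfl⟩ := List.length_eq_one_iff.1 hz
    obtain ⟨m', hbm', -, hm'v⟩ := hv b
    obtain ⟨es₃, u, hrun₃, hu, hum', -⟩ :=
      hf.exists_run hbm' (x := δ' :: y) (ρ := ρ) (by simpa using hzb)
        fun t h1 _ => hρ t (by omega)
    obtain ⟨γ', u, rfl⟩ := List.exists_cons_of_ne_nil hu
    have hvm : vertex (confs c f m') = vertex (confs c f m) := hm'v.trans hmv.symm
    simp only [vertex, Prod.mk.injEq] at hvm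
    have : γ' = γ := by simpa [hγ, hum'] using hvm.2
    subst this
    have hB : BddAbove (lev ((δ, (confs c f a).2), (δ', (confs c f b).2))) := by
      refine ⟨-(A.wt es₁ + A.wt es₃), ?_⟩
      rintro _ ⟨es, hes, rfl⟩
      have hes' := (hrun₁.append (hes.lift y)).append hrun₃
      rw [hvm.1] at hes'
      have := hc m γ' ρ _ u hγ hes'
      rw [A.wt_append, A.wt_append] at this
      linarith
    exact hw₂ ▸ (hC _ hB _ ⟨es₂, hrun₂, rfl⟩).trans (le_max_left _ _)
  refine ⟨A.prefixWt f m + (Finset.univ : Finset (Q × Option Γ)).card * (max C 0 + max M 0),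
    eventually_atTop.2 ⟨m, fun n hn => ?_⟩⟩
  have := hc.prefixWt_sub_le hf (le_max_right M 0) (le_max_right C 0)
    (fun i => (hM ⟨f i, rfl⟩).trans (le_max_left M 0)) hlevel Finset.univ m le_rfl hn
    (fun t h1 _ => hmmin t h1) fun _ _ _ _ => Finset.mem_univ _
  linarith

theorem tendsto_const_div_add_one_atTop (B : ℝ) :
    Tendsto (fun n : ℕ => B / ((n : ℝ) + 1)) atTop (nhds 0) := by
  simpa [Function.comp_def] using (tendsto_const_div_atTop_nhds_zero_nat B).comp (tendsto_add_atTop_nat 1)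

theorem limSupAvg_le_zero {A : WPS Q Γ} {f : ℕ → Edge Q Γ} {K : ℤ}
    (h : ∀ᶠ n in atTop, A.prefixWt f n ≤ K) : LimSupAvg A f ≤ 0 := by
  refine le_of_forall_pos_le_add fun ε hε => ?_
  rw [zero_add, LimSupAvg, limsup_eq]
  have hmem : ε ∈ {a | ∀ᶠ n in atTop, avgPref A f n ≤ a} := by
    have h0 : Tendsto (fun n : ℕ => (K : ℝ) / ((n : ℝ) + 1)) atTop (nhds 0) :=
      tendsto_const_div_add_one_atTop (K : ℝ)
    filter_upwards [(tendsto_add_atTop_nat 1).eventually h, h0.eventually_le_const hε]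
      with n h1 h2
    rw [avgPref_eq]
    refine le_trans ?_ h2
    have : (A.prefixWt f (n + 1) : ℝ) ≤ K := by exact_mod_cast h1
    gcongr
  by_cases hb : BddBelow {a | ∀ᶠ n in atTop, avgPref A f n ≤ a}
  · exact csInf_le hb hmem
  · rw [Real.sInf_of_not_bddBelow hb]
    exact hε.le

/-- The averages of an ultimately periodic sequence converge to the average of its period. -/
theorem tendsto_avgPref_of_periodic {A : WPS Q Γ} {f : ℕ → Edge Q Γ} {N p : ℕ} (hp : 0 < p)
    (hper : ∀ n, N ≤ n → f (n + p) = f n) :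
    Tendsto (avgPref A f) atTop
      (nhds (((A.prefixWt f (N + p) - A.prefixWt f N : ℤ) : ℝ) / p)) := by
  set S : ℤ := A.prefixWt f (N + p) - A.prefixWt f N with hS
  have hadd : ∀ k, A.prefixWt f (N + k + p) = A.prefixWt f (N + k) + S := by
    intro k
    induction k with
    | zero => simp [hS]
    | succ k ih =>
      rw [show N + (k + 1) + p = (N + k + p) + 1 by ring, A.prefixWt_succ, ih,
        hper _ (by omega), ← add_assoc N k 1, A.prefixWt_succ]
      ring
  have hp' : (p : ℝ) ≠ 0 := by positivity
  let g : ℕ → ℝ := fun n => A.prefixWt f n - n * ((S : ℝ) / p)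
  have hg : ∀ i k, g (N + i + p * k) = g (N + i) := by
    intro i k
    induction k with
    | zero => simp
    | succ k ih =>
      rw [← ih]
      simp only [g]
      rw [show N + i + p * (k + 1) = N + (i + p * k) + p by ring, hadd,
        show N + (i + p * k) = N + i + p * k by ring]
      push_cast
      field_simp
      ring
  obtain ⟨B, hB⟩ : ∃ B, ∀ n, |g n| ≤ B := by
    obtain ⟨B, hB⟩ := ((Set.finite_Iio (N + p)).image fun n => |g n|).bddAbove
    refine ⟨B, fun n => ?_⟩
    rcases lt_or_ge n N with h | h
    · exact hB ⟨n, by simp; omega, rfl⟩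
    · have hn : n = N + (n - N) % p + p * ((n - N) / p) := by
        have := Nat.mod_add_div (n - N) p
        omega
      rw [hn, hg]
      have := Nat.mod_lt (n - N) hp
      exact hB ⟨N + (n - N) % p, by simp; omega, rfl⟩
  have h0 : Tendsto (fun n : ℕ => g (n + 1) / ((n : ℝ) + 1)) atTop (nhds 0) := by
    refine squeeze_zero_norm (fun n => ?_)
      (tendsto_const_div_add_one_atTop B)
    rw [Real.norm_eq_abs, abs_div, abs_of_pos (by positivity : (0 : ℝ) < (n : ℝ) + 1)]
    have := hB (n + 1)
    gcongr
  have h1 := h0.add_const ((S : ℝ) / p)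
  rw [zero_add] at h1
  refine h1.congr fun n => ?_
  rw [avgPref_eq]
  have : (n : ℝ) + 1 ≠ 0 := by positivity
  simp only [g]
  push_cast
  field_simp
  ring

/-- Follow `f` for `N` steps, then repeat the edges `es` forever. -/
def lasso (f : ℕ → Edge Q Γ) (N : ℕ) (es : List (Edge Q Γ)) (n : ℕ) : Edge Q Γ :=
  if n < N then f n else es.getD ((n - N) % es.length) (f n)

theorem lasso_of_lt (f : ℕ → Edge Q Γ) {N n : ℕ} (es : List (Edge Q Γ)) (h : n < N) :
    lasso f N es n = f n := if_pos h

theorem lasso_add (f : ℕ → Edge Q Γ) (N : ℕ) (es : List (Edge Q Γ)) (k : ℕ) {i : ℕ}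
    (hi : i < es.length) : lasso f N es (N + es.length * k + i) = es[i] := by
  have h : (N + es.length * k + i - N) % es.length = i := by
    rw [show N + es.length * k + i - N = i + es.length * k by omega, Nat.add_mul_mod_self_left,
      Nat.mod_eq_of_lt hi]
  rw [lasso, if_neg (by omega), h]
  simp [hi]

theorem exists_eq_add_mul_add {N p n : ℕ} (hp : 0 < p) (hn : N ≤ n) :
    ∃ k i, i < p ∧ n = N + p * k + i := by
  refine ⟨(n - N) / p, (n - N) % p, Nat.mod_lt _ hp, ?_⟩
  have := Nat.mod_add_div (n - N) p
  omega

theorem lasso_periodic (f : ℕ → Edge Q Γ) (N : ℕ) {es : List (Edge Q Γ)} (hes : 0 < es.length)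
    (n : ℕ) (hn : N ≤ n) : lasso f N es (n + es.length) = lasso f N es n := by
  obtain ⟨k, i, hi, rfl⟩ := exists_eq_add_mul_add hes hn
  rw [lasso_add f N es k hi, show N + es.length * k + i + es.length
    = N + es.length * (k + 1) + i by ring, lasso_add f N es (k + 1) hi]

theorem prefixWt_lasso (A : WPS Q Γ) (f : ℕ → Edge Q Γ) (N : ℕ) (es : List (Edge Q Γ)) :
    A.prefixWt (lasso f N es) (N + es.length) - A.prefixWt (lasso f N es) N = A.wt es := by
  rw [WPS.prefixWt, WPS.prefixWt, Finset.sum_range_add, add_sub_cancel_left, WPS.wt,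
    Finset.sum_range, ← List.sum_ofFn]
  congr 1
  refine List.ext_getElem (by simp) fun i h1 h2 => ?_
  have hi : i < es.length := by simpa using h1
  have := lasso_add f N es 0 hi
  simp only [mul_zero, add_zero] at this
  simp [this]

theorem confs_lasso_of_le (c : Config Q Γ) (f : ℕ → Edge Q Γ) {N n : ℕ} (es : List (Edge Q Γ))
    (h : n ≤ N) : confs c (lasso f N es) n = confs c f n := by
  induction n with
  | zero => rfl
  | succ n ih => rw [confs, confs, ih (by omega), lasso_of_lt f es (by omega)]

theorem confs_lasso_add (c : Config Q Γ) (f : ℕ → Edge Q Γ) (N : ℕ) (es : List (Edge Q Γ))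
    (k : ℕ) {i : ℕ} (hi : i ≤ es.length) :
    confs c (lasso f N es) (N + es.length * k + i) =
      endc (confs c (lasso f N es) (N + es.length * k)) (es.take i) := by
  induction i with
  | zero => simp [endc]
  | succ i ih =>
    rw [← add_assoc, confs, ih (by omega), lasso_add f N es k (by omega),
      List.take_succ_eq_append_getElem (by omega), endc, endc, List.foldl_append]
    rfl

theorem WPS.ValidInf.lasso {A : WPS Q Γ} {c : Config Q Γ} {f : ℕ → Edge Q Γ}
    (hf : A.ValidInf c f) {N : ℕ} {γ : Γ} {ρ x : List Γ} {es : List (Edge Q Γ)}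
    (hN : (confs c f N).1 = γ :: ρ)
    (hes : A.Run ([γ], (confs c f N).2) es (γ :: x, (confs c f N).2)) (hpos : 0 < es.length) :
    A.ValidInf c (lasso f N es) := by
  have hround : ∀ k, ∃ σ, confs c (PDS.lasso f N es) (N + es.length * k)
      = (γ :: σ, (confs c f N).2) := by
    intro k
    induction k with
    | zero => exact ⟨ρ, by simp [confs_lasso_of_le, ← hN]⟩
    | succ k ih =>
      obtain ⟨σ, hσ⟩ := ih
      refine ⟨x ++ σ, ?_⟩
      rw [mul_add, mul_one, ← add_assoc, confs_lasso_add c f N es k le_rfl, hσ,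
        List.take_length]
      exact (hes.lift σ).2
  intro n
  rcases lt_or_ge n N with h | h
  · rw [confs_lasso_of_le c f es h.le, lasso_of_lt f es h]
    exact hf n
  · obtain ⟨k, i, hi, rfl⟩ := exists_eq_add_mul_add hpos h
    obtain ⟨σ, hσ⟩ := hround k
    rw [confs_lasso_add c f N es k hi.le, lasso_add f N es k hi, hσ]
    exact (hes.lift σ).1.enabled_getElem i hi

end PDS

open PDS in
/-- if there is an infinite path from the initial configuration with
positive limsup-average, then there is an ultimately periodic one with both
limsup-average and liminf-average positive. -/
theorem ultimately_periodic_witness_for_strict_mean_payoff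
    {Q Γ : Type} [Fintype Q] [Fintype Γ] (A : WPS Q Γ)
    (h : ∃ f : ℕ → Edge Q Γ, A.ValidInf A.start f ∧ 0 < LimSupAvg A f) :
    ∃ f : ℕ → Edge Q Γ, A.ValidInf A.start f ∧ UltPeriodic f ∧
      0 < LimSupAvg A f ∧ 0 < LimInfAvg A f := by
  obtain ⟨f, hf, hpos⟩ := h
  have hcyc : ¬ A.NoCycle A.start f := fun hc => by
    obtain ⟨K, hK⟩ := hc.exists_prefixWt_le hf
    exact hpos.not_ge (limSupAvg_le_zero hK)
  simp only [WPS.NoCycle, not_forall, not_le] at hcyc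
  obtain ⟨N, γ, ρ, es, x, hN, hrun, hwt⟩ := hcyc
  have hlen : 0 < es.length := List.length_pos_iff.2 fun h0 => by simp [h0, WPS.wt] at hwt
  have hper := lasso_periodic f N hlen
  have hlim := tendsto_avgPref_of_periodic (A := A) hlen hper
  rw [prefixWt_lasso] at hlim
  have hr : (0 : ℝ) < (A.wt es : ℝ) / es.length := by
    have : (0 : ℝ) < A.wt es := by exact_mod_cast hwt
    positivity
  exact ⟨lasso f N es, hf.lasso hN hrun hlen, ⟨N, es.length, hlen, hper⟩,
    by rwa [LimSupAvg, hlim.limsup_eq], by rwa [LimInfAvg, hlim.liminf_eq]⟩
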